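/- Let K be an algebraically closed field of characteristic 0, let n ≥ 3, k ≥ 1, l ≥ 2. Let t : ℕ → ℕ be given by t(i) = i+1 for 0 ≤ i ≤ n−1, t(j) = 3 for n ≤ j ≤ n+k, t(j) = 1 for n+k+1 ≤ j ≤ n+k+l, and t(j) = 0 for j > n+k+l. Then there exist finitely many homogeneous ideals J_1, …, J_m of K[x,y] such that every homogeneous ideal I of K[x,y] with t_I = t satisfies φ(I) = J_i for some linear change of variables φ and some i. -/

import Mathlib

open MvPolynomial

noncomputable section

/-- The polynomial ring `K[x,y]`. -/
abbrev Pxy (K : Type*) [Field K] := MvPolynomial (Fin 2) K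

/-- An ideal of `K[x,y]` is homogeneous if it contains all homogeneous
components of each of its elements. -/
def IsHomog {K : Type*} [Field K] (I : Ideal (Pxy K)) : Prop :=
  ∀ f ∈ I, ∀ k : ℕ, homogeneousComponent k f ∈ I

/-- The Hilbert function of an ideal:
`t_I(k) = dim_K (K[x,y]_k / (I ∩ K[x,y]_k))`. -/
def hilb (K : Type*) [Field K] (I : Ideal (Pxy K)) (k : ℕ) : ℕ :=
  Module.finrank K
    (homogeneousSubmodule (Fin 2) K k ⧸
      Submodule.comap (homogeneousSubmodule (Fin 2) K k).subtype (I.restrictScalars K))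

/-- A linear change of variables: a `K`-algebra automorphism sending the
variables to homogeneous polynomials of degree 1. -/
def IsLinChange {K : Type*} [Field K] (φ : Pxy K ≃ₐ[K] Pxy K) : Prop :=
  ∀ i : Fin 2, (φ (X i)).IsHomogeneous 1

/-- `t` is of homogeneous finite type: there are finitely many homogeneous ideals
`J₁, …, Jₘ` such that every homogeneous ideal `I` with Hilbert function `t` is
mapped onto some `Jᵢ` by a linear change of variables. -/
def HomogFiniteType (K : Type*) [Field K] (t : ℕ → ℕ) : Prop :=
  ∃ S : Set (Ideal (Pxy K)), S.Finite ∧ (∀ J ∈ S, IsHomog J) ∧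
    ∀ I : Ideal (Pxy K), IsHomog I → (∀ k, hilb K I k = t k) →
      ∃ φ : Pxy K ≃ₐ[K] Pxy K, IsLinChange φ ∧ Ideal.map φ I ∈ S

section

variable {K : Type*} [Field K]

theorem homogeneousComponent_mul_left {f : Pxy K} {e : ℕ} (hf : f.IsHomogeneous e) (q : Pxy K)
    (m : ℕ) : homogeneousComponent (e + m) (f * q) = f * homogeneousComponent m q := by
  conv_lhs => rw [← sum_homogeneousComponent q, Finset.mul_sum, map_sum]
  have h (i : ℕ) : homogeneousComponent (e + m) (f * homogeneousComponent i q) =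
      if i = m then f * homogeneousComponent m q else 0 := by
    rw [homogeneousComponent_of_mem (hf.mul (homogeneousComponent_isHomogeneous i q))]
    by_cases h : i = m
    · simp [h]
    · simp [h, Ne.symm h]
  simp only [h, Finset.sum_ite_eq', Finset.mem_range]
  split_ifs with hm
  · rfl
  · rw [homogeneousComponent_eq_zero _ _ (by omega), mul_zero]

theorem exists_homogeneous_of_dvd {f p : Pxy K} {e m : ℕ} (hf : f.IsHomogeneous e)
    (hp : p.IsHomogeneous (e + m)) (h : f ∣ p) : ∃ q, q.IsHomogeneous m ∧ p = f * q := by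
  obtain ⟨q, rfl⟩ := h
  refine ⟨homogeneousComponent m q, homogeneousComponent_isHomogeneous m q, ?_⟩
  rw [← homogeneousComponent_mul_left hf, homogeneousComponent_eq_self hp]

theorem exists_X_mul_add_X_mul {p : Pxy K} {d : ℕ} (hp : p.IsHomogeneous (d + 1)) :
    ∃ a b : Pxy K, a.IsHomogeneous d ∧ b.IsHomogeneous d ∧ p = X 0 * a + X 1 * b := by
  suffices h : p ∈ (homogeneousSubmodule (Fin 2) K d).map (LinearMap.mulLeft K (X 0)) ⊔
      (homogeneousSubmodule (Fin 2) K d).map (LinearMap.mulLeft K (X 1)) by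
    obtain ⟨_, ⟨a, ha, rfl⟩, _, ⟨b, hb, rfl⟩, h⟩ := Submodule.mem_sup.1 h
    exact ⟨a, b, ha, hb, h.symm⟩
  rw [p.as_sum]
  refine Submodule.sum_mem _ fun s hs ↦ ?_
  have hd : s.degree = d + 1 := (hp.degree_eq_sum_deg_support hs).symm
  have key (i : Fin 2) (hi : s i ≠ 0) : monomial s (coeff s p) ∈
      (homogeneousSubmodule (Fin 2) K d).map (LinearMap.mulLeft K (X i)) := by
    have hle : Finsupp.single i 1 ≤ s := by
      simpa using Nat.one_le_iff_ne_zero.2 hi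
    have hs' : Finsupp.single i 1 + (s - Finsupp.single i 1) = s := add_tsub_cancel_of_le hle
    refine ⟨monomial (s - Finsupp.single i 1) (coeff s p), ?_, ?_⟩
    · refine isHomogeneous_monomial _ ?_
      have := congrArg Finsupp.degree hs'
      rw [map_add, Finsupp.degree_single, hd] at this
      omega
    · simp [X, monomial_mul, hs']
  by_cases h0 : s 0 = 0
  · refine Submodule.mem_sup_right (key 1 fun h1 ↦ ?_)
    simp [Finsupp.degree_eq_sum, Fin.sum_univ_two, h0, h1] at hd
  · exact Submodule.mem_sup_left (key 0 h0)

instance (d : ℕ) : FiniteDimensional K (homogeneousSubmodule (Fin 2) K d) :=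
  Module.Finite.iff_fg.2 (homogeneousSubmodule_fg (Fin 2) K d)

theorem finrank_homogeneousSubmodule (d : ℕ) :
    Module.finrank K (homogeneousSubmodule (Fin 2) K d) = d + 1 := by
  rw [homogeneousSubmodule_eq_finsupp_supported,
    (AddMonoidAlgebra.supportedEquivFinsupp _).finrank_eq]
  have h : {s : Fin 2 →₀ ℕ | s.degree = d} =
      (Finset.finsuppAntidiag Finset.univ d : Finset (Fin 2 →₀ ℕ)) := by
    ext s
    simp [Finsupp.degree_eq_sum]
  rw [h, Module.finrank_finsupp_self]
  simp [Finset.card_finsuppAntidiag_nat_eq_choose, add_comm 1 d]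

theorem finrank_map_mulLeft {f : Pxy K} (hf : f ≠ 0) (V : Submodule K (Pxy K)) :
    Module.finrank K (V.map (LinearMap.mulLeft K f)) = Module.finrank K V :=
  (Submodule.equivMapOfInjective _ (mul_right_injective₀ hf) V).finrank_eq.symm

theorem map_mulLeft_le {f : Pxy K} {e d : ℕ} (hf : f.IsHomogeneous e) {V : Submodule K (Pxy K)}
    (hV : V ≤ homogeneousSubmodule (Fin 2) K d) :
    V.map (LinearMap.mulLeft K f) ≤ homogeneousSubmodule (Fin 2) K (e + d) := by
  rintro _ ⟨v, hv, rfl⟩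
  exact hf.mul (hV hv)

theorem exists_le_finrank_eq {V : Submodule K (Pxy K)} {m : ℕ} (hm : m ≤ Module.finrank K V) :
    ∃ W ≤ V, Module.finrank K W = m := by
  obtain ⟨s, hs, hli⟩ := exists_finset_linearIndependent_of_le_finrank hm
  refine ⟨(Submodule.span K (s : Set V)).map V.subtype, Submodule.map_subtype_le _ _, ?_⟩
  rw [Submodule.finrank_map_subtype_eq, finrank_span_finset_eq_card hli, hs]

/-- If `V` contains `f · K[x,y]_m` and has the same dimension, they are equal. -/
theorem mem_iff_dvd_of_finrank {V : Submodule K (Pxy K)} {f : Pxy K} {e m : ℕ} (hf0 : f ≠ 0)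
    (hf : f.IsHomogeneous e) (hV : V ≤ homogeneousSubmodule (Fin 2) K (e + m))
    (hdim : Module.finrank K V = m + 1)
    (hfV : ∀ q : Pxy K, q.IsHomogeneous m → f * q ∈ V) {p : Pxy K}
    (hp : p.IsHomogeneous (e + m)) : p ∈ V ↔ f ∣ p := by
  have := Submodule.finiteDimensional_of_le hV
  have h : (homogeneousSubmodule (Fin 2) K m).map (LinearMap.mulLeft K f) = V := by
    refine Submodule.eq_of_le_of_finrank_eq ?_ ?_
    · rintro _ ⟨q, hq, rfl⟩
      exact hfV q hq
    · rw [finrank_map_mulLeft hf0, finrank_homogeneousSubmodule, hdim]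
  constructor
  · rw [← h]
    rintro ⟨q, -, rfl⟩
    exact dvd_mul_right f q
  · intro hd
    obtain ⟨q, hq, rfl⟩ := exists_homogeneous_of_dvd hf hp hd
    exact hfV q hq

/-- A space `V` of forms of dimension `m + 1` such that `x V + y V` has dimension at most `m + 2`
contains `f · K[x,y]_m` for some form `f`. -/
theorem exists_common_factor (m : ℕ) : ∀ (d : ℕ) (V : Submodule K (Pxy K)),
    V ≤ homogeneousSubmodule (Fin 2) K d → Module.finrank K V = m + 1 →
    Module.finrank K ↥(V.map (LinearMap.mulLeft K (X 0)) ⊔ V.map (LinearMap.mulLeft K (X 1)))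
      ≤ m + 2 →
    ∃ (f : Pxy K) (e : ℕ), f ≠ 0 ∧ f.IsHomogeneous e ∧ e + m = d ∧
      ∀ q : Pxy K, q.IsHomogeneous m → f * q ∈ V := by
  induction m with
  | zero =>
    intro d V hV hdim _
    obtain ⟨f, hfV, hf0⟩ := Submodule.exists_mem_ne_zero_of_ne_bot
      (show V ≠ ⊥ by rintro rfl; simp at hdim)
    refine ⟨f, d, hf0, hV hfV, rfl, fun q hq ↦ ?_⟩
    obtain ⟨c, rfl⟩ : ∃ c, q = C c :=
      ⟨_, totalDegree_eq_zero_iff_eq_C.1 (Nat.le_zero.1 hq.totalDegree_le)⟩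
    rw [mul_comm, ← smul_eq_C_mul]
    exact V.smul_mem c hfV
  | succ m ih =>
    intro d V hV hdim hR
    have := Submodule.finiteDimensional_of_le hV
    set A := V.map (LinearMap.mulLeft K (X 0)) with hA
    set B := V.map (LinearMap.mulLeft K (X 1)) with hB
    have hAdim : Module.finrank K A = m + 2 := by rw [hA, finrank_map_mulLeft (X_ne_zero 0), hdim]
    have hBdim : Module.finrank K B = m + 2 := by rw [hB, finrank_map_mulLeft (X_ne_zero 1), hdim]
    have hsum := Submodule.finrank_sup_add_finrank_inf_eq A B
    set W : Submodule K (Pxy K) := V.comap (LinearMap.mulLeft K (X 0)) ⊓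
      V.comap (LinearMap.mulLeft K (X 1)) with hW
    have hmap : A ⊓ B ≤ W.map (LinearMap.mulLeft K (X 0 * X 1)) := by
      rintro _ ⟨⟨a, ha, rfl⟩, b, hb, hab⟩
      simp only [LinearMap.mulLeft_apply] at hab
      have hdvd : (X 1 : Pxy K) ∣ a := by
        have : (X 1 : Pxy K) ∣ X 0 * a := ⟨b, hab.symm⟩
        refine (X_prime.dvd_or_dvd this).resolve_left fun h ↦ ?_
        simp [X_dvd_X] at h
      obtain ⟨c, rfl⟩ := hdvd
      have hb' : b = X 0 * c := by
        apply mul_left_cancel₀ (X_ne_zero (R := K) (1 : Fin 2))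
        rw [hab]; ring
      subst hb'
      exact ⟨c, ⟨hb, ha⟩, by simp⟩
    have hinf : m + 1 ≤ Module.finrank K ↥(A ⊓ B) := by omega
    obtain ⟨U, hUle, hUdim⟩ := exists_le_finrank_eq hinf
    have hmap' : (U.comap (LinearMap.mulLeft K (X 0 * X 1))).map
        (LinearMap.mulLeft K (X 0 * X 1)) = U := by
      rw [Submodule.map_comap_eq, inf_eq_right]
      exact (hUle.trans hmap).trans (LinearMap.map_le_range)
    set W' := U.comap (LinearMap.mulLeft K (X 0 * X 1)) with hW'
    have hXX : (X 0 * X 1 : Pxy K) ≠ 0 := mul_ne_zero (X_ne_zero 0) (X_ne_zero 1)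
    have hW'W : W' ≤ W := by
      intro c hc
      obtain ⟨c', hc', h⟩ := hmap (hUle hc)
      rwa [← mul_right_injective₀ hXX h]
    have hW'dim : Module.finrank K W' = m + 1 := by
      rw [← hUdim, ← hmap', finrank_map_mulLeft hXX]
    have hd : d ≠ 0 := by
      rintro rfl
      have := Submodule.finrank_mono hV
      rw [finrank_homogeneousSubmodule] at this
      omega
    obtain ⟨d, rfl⟩ : ∃ d', d = 1 + d' := ⟨d - 1, by omega⟩
    have hW'd : W' ≤ homogeneousSubmodule (Fin 2) K d := by
      intro c hc
      obtain ⟨q, hq, h⟩ := exists_homogeneous_of_dvd (isHomogeneous_X K 0) (hV (hW'W hc).1)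
        (dvd_mul_right _ _)
      rwa [mul_right_injective₀ (X_ne_zero 0) h]
    obtain ⟨f, e, hf0, hf, hed, hfW⟩ := ih d W' hW'd hW'dim <| by
      rw [← hdim]
      refine Submodule.finrank_mono (sup_le ?_ ?_)
      · rintro _ ⟨c, hc, rfl⟩
        exact (hW'W hc).1
      · rintro _ ⟨c, hc, rfl⟩
        exact (hW'W hc).2
    refine ⟨f, e, hf0, hf, by omega, fun q hq ↦ ?_⟩
    obtain ⟨a, b, ha, hb, rfl⟩ := exists_X_mul_add_X_mul hq
    have := V.add_mem (hW'W (hfW a ha)).1 (hW'W (hfW b hb)).2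
    simp only [LinearMap.mulLeft_apply] at this
    convert this using 1
    ring

/-- The degree `d` part of an ideal. -/
def gradedPart (I : Ideal (Pxy K)) (d : ℕ) : Submodule K (Pxy K) :=
  homogeneousSubmodule (Fin 2) K d ⊓ I.restrictScalars K

theorem mem_gradedPart {I : Ideal (Pxy K)} {d : ℕ} {p : Pxy K} :
    p ∈ gradedPart I d ↔ p.IsHomogeneous d ∧ p ∈ I := Iff.rfl

theorem gradedPart_le (I : Ideal (Pxy K)) (d : ℕ) :
    gradedPart I d ≤ homogeneousSubmodule (Fin 2) K d := inf_le_left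

theorem hilb_add_finrank_gradedPart (I : Ideal (Pxy K)) (d : ℕ) :
    hilb K I d + Module.finrank K (gradedPart I d) = d + 1 := by
  rw [gradedPart, ← Submodule.map_comap_subtype, Submodule.finrank_map_subtype_eq, hilb,
    Submodule.finrank_quotient_add_finrank, finrank_homogeneousSubmodule]

theorem X_mul_mem_gradedPart {I : Ideal (Pxy K)} {d : ℕ} {p : Pxy K} (hp : p ∈ gradedPart I d)
    (i : Fin 2) : X i * p ∈ gradedPart I (d + 1) :=
  ⟨by simpa [add_comm] using (isHomogeneous_X K i).mul hp.1, I.mul_mem_left _ hp.2⟩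

/-- If the Hilbert function is constant equal to `c ≤ d` in degrees `d, …, e` with `d < e`, then in
these degrees the ideal consists of the multiples of one form of degree `c`. -/
theorem exists_dvd_iff_of_hilb_eq {I : Ideal (Pxy K)} {c d e : ℕ} (hcd : c ≤ d) (hde : d < e)
    (h : ∀ j, d ≤ j → j ≤ e → hilb K I j = c) :
    ∃ f : Pxy K, f ≠ 0 ∧ f.IsHomogeneous c ∧ ∀ j, d ≤ j → j ≤ e → ∀ p : Pxy K,
      p.IsHomogeneous j → (p ∈ I ↔ f ∣ p) := by
  obtain ⟨m, rfl⟩ := Nat.exists_eq_add_of_le hcd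
  have hdim (j : ℕ) (h1 : c + m ≤ j) (h2 : j ≤ e) :
      Module.finrank K (gradedPart I j) + c = j + 1 := by
    rw [← hilb_add_finrank_gradedPart I j, h j h1 h2, add_comm]
  obtain ⟨f, c', hf0, hf, hc', hfV⟩ := exists_common_factor m (c + m) (gradedPart I (c + m))
    (gradedPart_le I _) (by have := hdim (c + m) le_rfl (by omega); omega) <| by
      have h1 := hdim (c + m + 1) (by omega) (by omega)
      have := Submodule.finiteDimensional_of_le (gradedPart_le I (c + m + 1))
      refine (Submodule.finrank_mono (t := gradedPart I (c + m + 1)) (sup_le ?_ ?_)).trans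
        (by omega)
      · rintro _ ⟨p, hp, rfl⟩
        exact X_mul_mem_gradedPart hp 0
      · rintro _ ⟨p, hp, rfl⟩
        exact X_mul_mem_gradedPart hp 1
  obtain rfl : c' = c := by omega
  refine ⟨f, hf0, hf, fun j hj hje p hp ↦ ?_⟩
  obtain ⟨i, rfl⟩ := Nat.exists_eq_add_of_le hj
  have hmul (i : ℕ) : ∀ q : Pxy K, q.IsHomogeneous (m + i) → f * q ∈ I := by
    induction i with
    | zero => exact fun q hq ↦ (hfV q hq).2
    | succ i ih =>
      intro q hq
      obtain ⟨a, b, ha, hb, rfl⟩ := exists_X_mul_add_X_mul hq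
      rw [show f * (X 0 * a + X 1 * b) = X 0 * (f * a) + X 1 * (f * b) by ring]
      exact I.add_mem (I.mul_mem_left _ (ih a ha)) (I.mul_mem_left _ (ih b hb))
  have hdim' := hdim _ hj hje
  rw [add_assoc] at hp hdim'
  rw [← mem_iff_dvd_of_finrank (V := gradedPart I (c' + (m + i))) hf0 hf (gradedPart_le I _)
    (by omega) (fun q hq ↦ ⟨hf.mul hq, hmul i q hq⟩) hp, mem_gradedPart, and_iff_right hp]

/-- `I` is homogeneous, vanishes in degrees below `n`, is the ideal `(f)` in degrees `n, …, N`,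
the ideal `(g)` in degrees `N + 1, …, M`, and is everything in higher degrees. -/
def IsPiecewise (n N M : ℕ) (f g : Pxy K) (I : Ideal (Pxy K)) : Prop :=
  IsHomog I ∧ ∀ (j : ℕ) (p : Pxy K), p.IsHomogeneous j →
    (p ∈ I ↔ (j < n → p = 0) ∧ (n ≤ j → j ≤ N → f ∣ p) ∧ (N < j → j ≤ M → g ∣ p))

theorem IsPiecewise.unique {n N M : ℕ} {f g : Pxy K} {I J : Ideal (Pxy K)}
    (hI : IsPiecewise n N M f g I) (hJ : IsPiecewise n N M f g J) : I = J := by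
  have key {I J : Ideal (Pxy K)} (hI : IsPiecewise n N M f g I)
      (hJ : IsPiecewise n N M f g J) : I ≤ J := by
    intro p hp
    rw [← sum_homogeneousComponent p]
    refine J.sum_mem fun j _ ↦ ?_
    have hj := homogeneousComponent_isHomogeneous j p
    exact (hJ.2 j _ hj).2 ((hI.2 j _ hj).1 (hI.1 p hp j))
  exact le_antisymm (key hI hJ) (key hJ hI)

theorem IsPiecewise.of_associated {n N M : ℕ} {f g f' g' : Pxy K} {I : Ideal (Pxy K)}
    (hI : IsPiecewise n N M f g I) (hf : Associated f f') (hg : Associated g g') :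
    IsPiecewise n N M f' g' I := by
  refine ⟨hI.1, fun j p hp ↦ ?_⟩
  rw [hI.2 j p hp, hf.dvd_iff_dvd_left, hg.dvd_iff_dvd_left]

theorem exists_isPiecewise {n k l : ℕ} (hn : 3 ≤ n) (hk : 1 ≤ k) (hl : 2 ≤ l)
    {I : Ideal (Pxy K)} (hI : IsHomog I)
    (h : ∀ j, hilb K I j = if j < n then j + 1 else if j ≤ n + k then 3
        else if j ≤ n + k + l then 1 else 0) :
    ∃ f g : Pxy K, f ≠ 0 ∧ g ≠ 0 ∧ f.IsHomogeneous 3 ∧ g.IsHomogeneous 1 ∧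
      IsPiecewise n (n + k) (n + k + l) f g I := by
  obtain ⟨f, hf0, hf, hfI⟩ := exists_dvd_iff_of_hilb_eq (I := I) (c := 3) (d := n) (e := n + k)
    hn (by omega) (fun j h1 h2 ↦ by rw [h, if_neg (by omega), if_pos h2])
  obtain ⟨g, hg0, hg, hgI⟩ := exists_dvd_iff_of_hilb_eq (I := I) (c := 1) (d := n + k + 1)
    (e := n + k + l) (by omega) (by omega)
    (fun j h1 h2 ↦ by rw [h, if_neg (by omega), if_neg (by omega), if_pos h2])
  refine ⟨f, g, hf0, hg0, hf, hg, hI, fun j p hp ↦ ?_⟩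
  have hdim := hilb_add_finrank_gradedPart I j
  rw [h] at hdim
  have := Submodule.finiteDimensional_of_le (gradedPart_le I j)
  rcases lt_or_ge j n with h1 | h1
  · rw [if_pos h1] at hdim
    have hbot : gradedPart I j = ⊥ := Submodule.finrank_eq_zero.1 (by omega)
    have : p ∈ I ↔ p ∈ gradedPart I j := (and_iff_right hp).symm
    rw [this, hbot, Submodule.mem_bot]
    exact ⟨fun h ↦ ⟨fun _ ↦ h, by omega, by omega⟩, fun h ↦ h.1 h1⟩
  rcases le_or_gt j (n + k) with h2 | h2
  · rw [hfI j h1 h2 p hp]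
    exact ⟨fun h ↦ ⟨by omega, fun _ _ ↦ h, by omega⟩, fun h ↦ h.2.1 h1 h2⟩
  rcases le_or_gt j (n + k + l) with h3 | h3
  · rw [hgI j h2 h3 p hp]
    exact ⟨fun h ↦ ⟨by omega, by omega, fun _ _ ↦ h⟩, fun h ↦ h.2.2 h2 h3⟩
  · rw [if_neg (by omega), if_neg (by omega), if_neg (by omega), zero_add] at hdim
    have htop : gradedPart I j = homogeneousSubmodule (Fin 2) K j :=
      Submodule.eq_of_le_of_finrank_eq (gradedPart_le I j)
        (by rw [hdim, finrank_homogeneousSubmodule])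
    have hpI : p ∈ gradedPart I j := htop ▸ hp
    exact iff_of_true hpI.2 ⟨by omega, by omega, by omega⟩

theorem IsLinChange.isHomogeneous {φ : Pxy K ≃ₐ[K] Pxy K} (hφ : IsLinChange φ) {p : Pxy K} {d : ℕ}
    (hp : p.IsHomogeneous d) : (φ p).IsHomogeneous d := by
  have h : φ p = aeval (fun i ↦ φ (X i)) p :=
    DFunLike.congr_fun (aeval_unique (φ : Pxy K →ₐ[K] Pxy K)) p
  rw [h]
  simpa using hp.aeval (fun i ↦ φ (X i)) hφ

theorem IsLinChange.homogeneousComponent {φ : Pxy K ≃ₐ[K] Pxy K} (hφ : IsLinChange φ) (p : Pxy K)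
    (d : ℕ) : homogeneousComponent d (φ p) = φ (homogeneousComponent d p) := by
  conv_lhs => rw [← sum_homogeneousComponent p, map_sum, map_sum]
  have h (i : ℕ) : MvPolynomial.homogeneousComponent d (φ (MvPolynomial.homogeneousComponent i p)) =
      if i = d then φ (MvPolynomial.homogeneousComponent d p) else 0 := by
    rw [homogeneousComponent_of_mem (hφ.isHomogeneous (homogeneousComponent_isHomogeneous i p))]
    by_cases h : i = d
    · simp [h]
    · simp [h, Ne.symm h]
  simp only [h, Finset.sum_ite_eq', Finset.mem_range]
  split_ifs with hm
  · rfl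
  · rw [homogeneousComponent_eq_zero _ _ (by omega), map_zero]

theorem IsLinChange.trans {φ ψ : Pxy K ≃ₐ[K] Pxy K} (hφ : IsLinChange φ) (hψ : IsLinChange ψ) :
    IsLinChange (φ.trans ψ) := fun i ↦ hψ.isHomogeneous (hφ i)

theorem mem_map_algEquiv {φ : Pxy K ≃ₐ[K] Pxy K} {I : Ideal (Pxy K)} {p : Pxy K} :
    p ∈ I.map φ ↔ φ.symm p ∈ I := by
  rw [Ideal.mem_map_iff_of_surjective φ φ.surjective]
  constructor
  · rintro ⟨q, hq, rfl⟩
    rwa [φ.symm_apply_apply]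
  · exact fun h ↦ ⟨_, h, φ.apply_symm_apply p⟩

theorem dvd_algEquiv_symm_iff (φ : Pxy K ≃ₐ[K] Pxy K) {f p : Pxy K} :
    f ∣ φ.symm p ↔ φ f ∣ p := by
  rw [← map_dvd_iff φ, φ.apply_symm_apply]

theorem IsPiecewise.map {n N M : ℕ} {f g : Pxy K} {I : Ideal (Pxy K)} {φ : Pxy K ≃ₐ[K] Pxy K}
    (hI : IsPiecewise n N M f g I) (hφ' : IsLinChange φ.symm) :
    IsPiecewise n N M (φ f) (φ g) (I.map φ) := by
  refine ⟨fun p hp j ↦ ?_, fun j p hp ↦ ?_⟩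
  · rw [mem_map_algEquiv] at hp ⊢
    rw [← hφ'.homogeneousComponent]
    exact hI.1 _ hp j
  · rw [mem_map_algEquiv, hI.2 j _ (hφ'.isHomogeneous hp), dvd_algEquiv_symm_iff,
      dvd_algEquiv_symm_iff, EmbeddingLike.map_eq_zero_iff]

/-- The linear form `a x + b y`. -/
def linForm (a b : K) : Pxy K := C a * X 0 + C b * X 1

theorem isHomogeneous_linForm (a b : K) : (linForm a b).IsHomogeneous 1 :=
  (isHomogeneous_C_mul_X a 0).add (isHomogeneous_C_mul_X b 1)

theorem exists_linForm_eq {p : Pxy K} (hp : p.IsHomogeneous 1) : ∃ a b, p = linForm a b := by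
  obtain ⟨q, r, hq, hr, rfl⟩ := exists_X_mul_add_X_mul hp
  have hC {q : Pxy K} (hq : q.IsHomogeneous 0) : ∃ c, q = C c :=
    ⟨_, totalDegree_eq_zero_iff_eq_C.1 (Nat.le_zero.1 hq.totalDegree_le)⟩
  obtain ⟨a, rfl⟩ := hC hq
  obtain ⟨b, rfl⟩ := hC hr
  exact ⟨a, b, by rw [linForm]; ring⟩

theorem aeval_linForm (u : Fin 2 → Pxy K) (a b : K) :
    aeval u (linForm a b) = C a * u 0 + C b * u 1 := by
  simp [linForm, algebraMap_eq]

theorem exists_linChange {a b c d : K} (h : a * d - b * c ≠ 0) :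
    ∃ φ : Pxy K ≃ₐ[K] Pxy K, IsLinChange φ ∧ IsLinChange φ.symm ∧
      φ (X 0) = linForm a b ∧ φ (X 1) = linForm c d := by
  set D := (a * d - b * c)⁻¹ with hD
  have hD1 : C (D * (a * d - b * c)) = (1 : Pxy K) := by rw [hD, inv_mul_cancel₀ h, C_1]
  simp only [map_mul, map_sub] at hD1
  let F : Pxy K →ₐ[K] Pxy K := aeval ![linForm a b, linForm c d]
  let G : Pxy K →ₐ[K] Pxy K := aeval ![linForm (D * d) (-(D * b)), linForm (-(D * c)) (D * a)]
  have hFG : F.comp G = AlgHom.id K _ := by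
    ext1 i
    fin_cases i
    · simp only [F, G, AlgHom.comp_apply, aeval_X, Fin.zero_eta, Matrix.cons_val_zero,
        aeval_linForm, Matrix.cons_val_one, AlgHom.id_apply]
      simp only [linForm, map_mul, map_neg]
      linear_combination X 0 * hD1
    · simp only [F, G, AlgHom.comp_apply, aeval_X, Fin.mk_one, Matrix.cons_val_zero,
        aeval_linForm, Matrix.cons_val_one, AlgHom.id_apply]
      simp only [linForm, map_mul, map_neg]
      linear_combination X 1 * hD1
  have hGF : G.comp F = AlgHom.id K _ := by
    ext1 i
    fin_cases i
    · simp only [F, G, AlgHom.comp_apply, aeval_X, Fin.zero_eta, Matrix.cons_val_zero,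
        aeval_linForm, Matrix.cons_val_one, AlgHom.id_apply]
      simp only [linForm, map_mul, map_neg]
      linear_combination X 0 * hD1
    · simp only [F, G, AlgHom.comp_apply, aeval_X, Fin.mk_one, Matrix.cons_val_zero,
        aeval_linForm, Matrix.cons_val_one, AlgHom.id_apply]
      simp only [linForm, map_mul, map_neg]
      linear_combination X 1 * hD1
  have hF0 : F (X 0) = linForm a b := by simp [F]
  have hF1 : F (X 1) = linForm c d := by simp [F]
  refine ⟨AlgEquiv.ofAlgHom F G hFG hGF, fun i ↦ ?_, fun i ↦ ?_, hF0, hF1⟩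
  · change (F (X i)).IsHomogeneous 1
    fin_cases i <;> simp [F, isHomogeneous_linForm]
  · change (G (X i)).IsHomogeneous 1
    fin_cases i <;> simp [G, isHomogeneous_linForm]

/-- The cubics divisible by `x`, up to linear changes of variables preserving the line `x = 0`. -/
def cubicNormalForms (K : Type*) [Field K] : Set (Pxy K) :=
  {X 0 * (X 0 * X 0), X 0 * (X 0 * X 1), X 0 * (X 1 * X 1), X 0 * (X 1 * (X 0 + X 1))}

theorem exists_cubicNormalForm [IsAlgClosed K] {q : Pxy K} (hq0 : q ≠ 0)
    (hq : q.IsHomogeneous 2) : ∃ φ : Pxy K ≃ₐ[K] Pxy K, IsLinChange φ ∧ IsLinChange φ.symm ∧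
      ∃ h ∈ cubicNormalForms K, ∃ u v : K, u ≠ 0 ∧ v ≠ 0 ∧
        C v * φ h = C u * (X 0 * q) ∧ φ (X 0) = C u * X 0 := by
  obtain ⟨a, b, c, rfl⟩ : ∃ a b c : K,
      q = C a * (X 0 * X 0) + C b * (X 0 * X 1) + C c * (X 1 * X 1) := by
    obtain ⟨r, s, hr, hs, rfl⟩ := exists_X_mul_add_X_mul hq
    obtain ⟨a, b, rfl⟩ := exists_linForm_eq hr
    obtain ⟨b', c, rfl⟩ := exists_linForm_eq hs
    exact ⟨a, b + b', c, by simp only [linForm, map_add]; ring⟩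
  by_cases hc : c = 0
  · subst hc
    by_cases hb : b = 0
    · subst hb
      have ha : a ≠ 0 := by rintro rfl; simp at hq0
      obtain ⟨φ, h, h', h0, h1⟩ := exists_linChange (a := (1 : K)) (b := 0) (c := 0) (d := 1)
        (by simp)
      refine ⟨φ, h, h', _, Or.inl rfl, 1, a, one_ne_zero, ha, ?_, ?_⟩
      · simp only [map_mul, h0, linForm, C_0, C_1]; ring
      · simp [h0, linForm]
    · obtain ⟨φ, h, h', h0, h1⟩ := exists_linChange (a := (1 : K)) (b := 0) (c := a) (d := b)
        (by simpa)
      refine ⟨φ, h, h', _, Or.inr (Or.inl rfl), 1, 1, one_ne_zero, one_ne_zero, ?_, ?_⟩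
      · simp only [map_mul, h0, h1, linForm, C_0, C_1]; ring
      · simp [h0, linForm]
  · obtain ⟨r, hr⟩ := IsAlgClosed.exists_root
      (Polynomial.C c * Polynomial.X ^ 2 + Polynomial.C b * Polynomial.X + Polynomial.C a)
      (by rw [Polynomial.degree_quadratic hc]; decide)
    simp only [Polynomial.IsRoot, Polynomial.eval_add, Polynomial.eval_mul, Polynomial.eval_C,
      Polynomial.eval_pow, Polynomial.eval_X] at hr
    obtain ⟨s, rfl⟩ : ∃ s, b = -(c * (r + s)) := ⟨-(b / c) - r, by field_simp; ring⟩
    obtain rfl : a = c * (r * s) := by linear_combination hr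
    by_cases hrs : r = s
    · subst hrs
      obtain ⟨φ, h, h', h0, h1⟩ := exists_linChange (a := (1 : K)) (b := 0) (c := -r) (d := 1)
        (by simp)
      refine ⟨φ, h, h', _, Or.inr (Or.inr (Or.inl rfl)), 1, c, one_ne_zero, hc, ?_, ?_⟩
      · simp only [map_mul, h0, h1, linForm, C_0, C_1, map_neg, map_add]; ring
      · simp [h0, linForm]
    · obtain ⟨φ, h, h', h0, h1⟩ := exists_linChange (a := r - s) (b := 0) (c := -r) (d := 1)
        (by simpa [sub_eq_zero] using hrs)
      refine ⟨φ, h, h', _, Or.inr (Or.inr (Or.inr rfl)), r - s, c, sub_ne_zero.2 hrs, hc, ?_, ?_⟩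
      · simp only [map_mul, h0, h1, linForm, C_0, C_1, map_neg, map_add, map_sub]; ring
      · simp [h0, linForm]

theorem IsPiecewise.dvd {n N M : ℕ} {f g : Pxy K} {I : Ideal (Pxy K)}
    (hI : IsPiecewise n N M f g I) (hf : f.IsHomogeneous 3) (hN : 3 ≤ N) (hn : n ≤ N)
    (hM : N < M) (i : Fin 2) : ∃ r, g ∣ f * X i ^ r := by
  obtain ⟨r, rfl⟩ := Nat.exists_eq_add_of_le hN
  have h1 : f * X i ^ r ∈ I :=
    (hI.2 (3 + r) _ (hf.mul (isHomogeneous_X_pow i r))).2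
      ⟨by omega, fun _ _ ↦ dvd_mul_right _ _, by omega⟩
  have h2 : f * X i ^ (r + 1) ∈ I := by
    rw [pow_succ, ← mul_assoc]
    exact I.mul_mem_right _ h1
  exact ⟨r + 1, ((hI.2 (3 + (r + 1)) _ (hf.mul (isHomogeneous_X_pow i (r + 1)))).1 h2).2.2
    (by omega) (by omega)⟩

theorem exists_linChange_apply_eq_X {g : Pxy K} (hg0 : g ≠ 0) (hg : g.IsHomogeneous 1) :
    ∃ φ : Pxy K ≃ₐ[K] Pxy K, IsLinChange φ ∧ IsLinChange φ.symm ∧ φ g = X 0 := by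
  obtain ⟨a, b, rfl⟩ := exists_linForm_eq hg
  obtain ⟨c, d, h⟩ : ∃ c d : K, a * d - b * c ≠ 0 := by
    by_cases ha : a = 0
    · refine ⟨1, 0, ?_⟩
      rintro h
      obtain rfl : b = 0 := by simpa using h
      simp [linForm, ha] at hg0
    · exact ⟨0, 1, by simpa⟩
  obtain ⟨φ, hφ, hφ', h0, -⟩ := exists_linChange h
  exact ⟨φ.symm, hφ', hφ, by rw [← h0, φ.symm_apply_apply]⟩

theorem associated_C_mul {u : K} (hu : u ≠ 0) (p : Pxy K) : Associated (C u * p) p :=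
  (associated_unit_mul_left p _ ((isUnit_iff_ne_zero.2 hu).map C))

theorem IsPiecewise.exists_map_cubicNormalForm [IsAlgClosed K] {n N M : ℕ} {f g : Pxy K}
    {I : Ideal (Pxy K)} (hI : IsPiecewise n N M f g I) (hf0 : f ≠ 0) (hg0 : g ≠ 0)
    (hf : f.IsHomogeneous 3) (hg : g.IsHomogeneous 1) (hN : 3 ≤ N) (hn : n ≤ N) (hM : N < M) :
    ∃ φ : Pxy K ≃ₐ[K] Pxy K, IsLinChange φ ∧ ∃ h ∈ cubicNormalForms K,
      IsPiecewise n N M h (X 0) (I.map φ) := by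
  obtain ⟨φ, hφ, hφ', hφg⟩ := exists_linChange_apply_eq_X hg0 hg
  have hI' := hI.map hφ'
  have hf' := hφ.isHomogeneous hf
  rw [hφg] at hI'
  obtain ⟨r, hr⟩ := hI'.dvd hf' hN hn hM 1
  have hX : (X 0 : Pxy K) ∣ φ f := by
    refine (X_prime.dvd_or_dvd hr).resolve_right fun h ↦ ?_
    simpa [X_dvd_X] using X_prime.dvd_of_dvd_pow h
  obtain ⟨q, hq, hfq⟩ := exists_homogeneous_of_dvd (m := 2) (isHomogeneous_X K 0) hf' hX
  have hq0 : q ≠ 0 := by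
    rintro rfl
    simp [hf0] at hfq
  obtain ⟨ψ, hψ, hψ', h, hh, u, v, hu, hv, hψh, hψX⟩ := exists_cubicNormalForm hq0 hq
  refine ⟨φ.trans ψ.symm, hφ.trans hψ', h, hh, ?_⟩
  have hmap : I.map (φ.trans ψ.symm) = (I.map φ).map ψ.symm := by
    ext p
    simp only [mem_map_algEquiv]
    rfl
  rw [hmap]
  refine (hI'.map (φ := ψ.symm) hψ).of_associated ?_ ?_
  · have h1 : Associated (φ f) (ψ h) := by
      rw [hfq]
      exact (associated_C_mul hu _).symm.trans (hψh ▸ associated_C_mul hv _)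
    simpa using h1.map ψ.symm
  · have h1 : Associated (X 0) (ψ (X 0)) := by
      rw [hψX]
      exact (associated_C_mul hu _).symm
    simpa using h1.map ψ.symm

end

/-- The sequence `T₉ = (1, 2, …, n, 3, …, 3, 1, …, 1)` is of homogeneous finite
type. -/
theorem stmt11 (K : Type*) [Field K] [IsAlgClosed K] [CharZero K]
    (n k l : ℕ) (hn : 3 ≤ n) (hk : 1 ≤ k) (hl : 2 ≤ l) :
    HomogFiniteType K
      (fun j => if j < n then j + 1 else if j ≤ n + k then 3
        else if j ≤ n + k + l then 1 else 0) := by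
  refine ⟨⋃ h ∈ cubicNormalForms K, {I | IsPiecewise n (n + k) (n + k + l) h (X 0) I}, ?_, ?_, ?_⟩
  · refine Set.Finite.biUnion (by simp [cubicNormalForms]) fun h _ ↦ ?_
    exact Set.Subsingleton.finite fun I hI J hJ ↦ IsPiecewise.unique hI hJ
  · simp only [Set.mem_iUnion]
    rintro J ⟨h, -, hJ⟩
    exact hJ.1
  · intro I hI ht
    obtain ⟨f, g, hf0, hg0, hf, hg, hfg⟩ := exists_isPiecewise hn hk hl hI ht
    obtain ⟨φ, hφ, h, hh, hIh⟩ := hfg.exists_map_cubicNormalForm hf0 hg0 hf hg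
      (by omega) (by omega) (by omega)
    exact ⟨φ, hφ, Set.mem_biUnion hh hIh⟩
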